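/- Fix τ with τ > 1. Then as N → ∞ over positive integers, 2 − τ·( ψ(N(τ + 1/2) + 1/2) − ψ(N(τ − 1/2) + 1/2) ) = 2 − τ·log((2τ + 1)/(2τ − 1)) + 4τ²/(3N²(4τ² − 1)²) + O(N⁻⁴); that is, there exist C > 0 and N₀ such that for all N ≥ N₀ the difference between the left-hand side and 2 − τ·log((2τ+1)/(2τ−1)) + 4τ²/(3N²(4τ²−1)²) is at most C·N⁻⁴ in absolute value. -/

import Mathlib

open Real

/-- The digamma function `ψ(x) = Γ'(x)/Γ(x)` on the reals. -/
noncomputable def digamma (x : ℝ) : ℝ := deriv Real.Gamma x / Real.Gamma x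

lemma aux_hasDeriv {x : ℝ} (hx : 0 < x) :
    HasDerivAt (Real.log ∘ Real.Gamma) (digamma x) x := by
  have h := (Real.differentiableAt_Gamma (s := x)
    (fun m => by have : (0:ℝ) ≤ m := Nat.cast_nonneg m
                 linarith)).hasDerivAt
  exact h.log (Real.Gamma_pos_of_pos hx).ne'

lemma aux_feq {x : ℝ} (hx : 0 < x) :
    (Real.log ∘ Real.Gamma) (x + 1) = (Real.log ∘ Real.Gamma) x + Real.log x := by
  simp only [Function.comp_apply]
  rw [Real.Gamma_add_one hx.ne', Real.log_mul hx.ne' (Real.Gamma_pos_of_pos hx).ne', add_comm]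

lemma aux_rec {x : ℝ} (hx : 0 < x) : digamma (x + 1) = digamma x + 1 / x := by
  have h1 : HasDerivAt (fun y => (Real.log ∘ Real.Gamma) (y + 1)) (digamma (x + 1)) x :=
    (aux_hasDeriv (by linarith : 0 < x + 1)).comp_add_const x 1
  have h2 : HasDerivAt (fun y => (Real.log ∘ Real.Gamma) y + Real.log y)
      (digamma x + x⁻¹) x := (aux_hasDeriv hx).add (Real.hasDerivAt_log hx.ne')
  have h3 : (fun y => (Real.log ∘ Real.Gamma) (y + 1)) =ᶠ[nhds x]
      (fun y => (Real.log ∘ Real.Gamma) y + Real.log y) := by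
    filter_upwards [lt_mem_nhds hx] with y hy using aux_feq hy
  rw [one_div]
  exact h1.unique (h2.congr_of_eventuallyEq h3)

lemma aux_le {x : ℝ} (hx : 0 < x) : digamma x ≤ Real.log x := by
  have := Real.convexOn_log_Gamma.le_slope_of_hasDerivAt (x := x) (y := x + 1)
    (Set.mem_Ioi.2 hx) (Set.mem_Ioi.2 (by linarith)) (by linarith) (aux_hasDeriv hx)
  rw [slope_def_field, aux_feq hx] at this
  simpa using this

lemma aux_ge {x : ℝ} (hx : 0 < x) : Real.log x ≤ digamma (x + 1) := by
  have := Real.convexOn_log_Gamma.slope_le_of_hasDerivAt (x := x) (y := x + 1)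
    (Set.mem_Ioi.2 hx) (Set.mem_Ioi.2 (by linarith)) (by linarith)
    (aux_hasDeriv (by linarith : 0 < x + 1))
  rw [slope_def_field, aux_feq hx] at this
  simpa using this

lemma aux_nonneg {f f' : ℝ → ℝ} (hd : ∀ x > 0, HasDerivAt f (f' x) x)
    (hn : ∀ x > 0, f' x ≤ 0) (ht : Filter.Tendsto f Filter.atTop (nhds 0)) {x : ℝ} (hx : 0 < x) :
    0 ≤ f x := by
  have ha : AntitoneOn f (Set.Ioi 0) := by
    apply antitoneOn_of_deriv_nonpos (convex_Ioi 0)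
    · intro y hy
      exact (hd y hy).continuousAt.continuousWithinAt
    · intro y hy
      rw [interior_Ioi] at hy
      exact (hd y hy).differentiableAt.differentiableWithinAt
    · intro y hy
      rw [interior_Ioi] at hy
      rw [(hd y hy).deriv]
      exact hn y hy
  apply le_of_tendsto ht
  filter_upwards [Filter.eventually_ge_atTop x] with y hy
  exact ha (Set.mem_Ioi.2 hx) (Set.mem_Ioi.2 (by linarith)) hy

/-- step function -/
noncomputable def auxD (y : ℝ) : ℝ :=
  1 / (y + 1 / 2) - (Real.log (y + 1) - Real.log y) - (1 / 24) * (1 / (y + 1) ^ 2 - 1 / y ^ 2)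

noncomputable def auxH (y : ℝ) : ℝ := 1 / y ^ 4 - 1 / (y + 1) ^ 4

open Filter Topology in
lemma aux_pow (c : ℝ) (n : ℕ) (hn : n ≠ 0) :
    Tendsto (fun y : ℝ => 1 / (y + c) ^ n) atTop (𝓝 0) := by
  simp only [one_div]
  exact tendsto_inv_atTop_zero.comp
    ((tendsto_pow_atTop hn).comp (tendsto_atTop_add_const_right _ c tendsto_id))

open Filter Topology in
lemma aux_logt (c : ℝ) :
    Tendsto (fun y : ℝ => Real.log (y + c) - Real.log y) atTop (𝓝 0) := by
  have h1 : Tendsto (fun y : ℝ => 1 + c * (1 / (y + 0) ^ 1)) atTop (𝓝 1) := by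
    simpa using ((aux_pow 0 1 one_ne_zero).const_mul c).const_add 1
  have h2 := (Real.continuousAt_log one_ne_zero).tendsto.comp h1
  rw [Real.log_one] at h2
  refine h2.congr' ?_
  filter_upwards [eventually_gt_atTop 0, eventually_gt_atTop (-c)] with y hy hc
  rw [← Real.log_div (by linarith) hy.ne']
  simp only [Function.comp_apply]
  congr 1
  field_simp
  ring

open Filter Topology in
lemma auxD_t : Tendsto auxD atTop (𝓝 0) := by
  have h1 := aux_pow (1/2) 1 one_ne_zero
  have h2 := aux_pow 1 2 two_ne_zero
  have h3 := aux_pow 0 2 two_ne_zero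
  have := (h1.sub (aux_logt 1)).sub ((h2.sub h3).const_mul (1/24))
  rw [show auxD = fun y => _ from funext fun y => auxD.eq_1 y]
  simpa using this

open Filter Topology in
lemma auxH_t : Tendsto auxH atTop (𝓝 0) := by
  have h2 := aux_pow 1 4 four_ne_zero
  have h3 := aux_pow 0 4 four_ne_zero
  have := h3.sub h2
  rw [show auxH = fun y => _ from funext fun y => auxH.eq_1 y]
  simpa using this

lemma aux_dpow (c : ℝ) (n : ℕ) {y : ℝ} (hy : 0 < y + c) :
    HasDerivAt (fun y : ℝ => 1 / (y + c) ^ n) (-(n * (y + c) ^ (n - 1)) / ((y + c) ^ n) ^ 2) y := by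
  have h : HasDerivAt (fun y : ℝ => (y + c) ^ n) (n * (y + c) ^ (n - 1)) y := by
    refine (((hasDerivAt_id y).add_const c).pow n).congr_deriv ?_
    simp
  simp only [one_div]
  exact h.inv (by positivity)

lemma auxD_d {y : ℝ} (hy : 0 < y) : HasDerivAt auxD
    (-1 / (16 * (y * (y + 1)) ^ 2 * (y + 1 / 2) ^ 2) - 1 / (12 * (y * (y + 1)) ^ 3)) y := by
  have h1 := aux_dpow (1/2) 1 (y := y) (by linarith)
  have h2 := aux_dpow 1 2 (y := y) (by linarith)
  have h3 := aux_dpow 0 2 (y := y) (by linarith)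
  have hl1 : HasDerivAt (fun y : ℝ => Real.log (y + 1)) (1 / (y + 1)) y :=
    ((hasDerivAt_id y).add_const 1).log (by simp; linarith)
  have hl2 := Real.hasDerivAt_log hy.ne'
  have := (h1.sub (hl1.sub hl2)).sub ((h2.sub h3).const_mul (1/24))
  refine (this.congr_of_eventuallyEq (Filter.Eventually.of_forall fun z => ?_)).congr_deriv ?_
  · simp [auxD]
  · simp
    field_simp
    ring

lemma auxH_d {y : ℝ} (hy : 0 < y) : HasDerivAt auxH
    (-4 * ((y + 1) ^ 5 - y ^ 5) / (y * (y + 1)) ^ 5) y := by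
  have h2 := aux_dpow 1 4 (y := y) (by linarith)
  have h3 := aux_dpow 0 4 (y := y) (by linarith)
  refine ((h3.sub h2).congr_of_eventuallyEq
    (Filter.Eventually.of_forall fun z => ?_)).congr_deriv ?_
  · simp [auxH]
  · simp
    field_simp
    ring

lemma auxD_nonneg {y : ℝ} (hy : 0 < y) : 0 ≤ auxD y := by
  refine aux_nonneg (fun x hx => auxD_d hx) (fun x hx => ?_) auxD_t hy
  have : 0 < 1 / (16 * (x * (x + 1)) ^ 2 * (x + 1 / 2) ^ 2) := by positivity
  have : 0 < 1 / (12 * (x * (x + 1)) ^ 3) := by positivity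
  rw [neg_div]
  linarith

lemma auxD_le {y : ℝ} (hy : 0 < y) : auxD y ≤ auxH y := by
  have := aux_nonneg (f := fun y => auxH y - auxD y) (fun x hx => (auxH_d hx).sub (auxD_d hx))
    (fun x hx => ?_) (by simpa using auxH_t.sub auxD_t) hy
  · linarith
  have hp : 0 < x * (x + 1) := by positivity
  have h1 : 1 / (16 * (x * (x + 1)) ^ 2 * (x + 1 / 2) ^ 2) ≤ 1 / (x * (x + 1)) ^ 3 := by
    apply one_div_le_one_div_of_le (by positivity)
    have : x * (x + 1) ≤ 16 * (x + 1 / 2) ^ 2 := by nlinarith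
    calc (x * (x + 1)) ^ 3 = (x * (x + 1)) ^ 2 * (x * (x + 1)) := by ring
      _ ≤ (x * (x + 1)) ^ 2 * (16 * (x + 1 / 2) ^ 2) := by gcongr
      _ = _ := by ring
  have h2 : 1 / (12 * (x * (x + 1)) ^ 3) ≤ 1 / (x * (x + 1)) ^ 3 := by
    apply one_div_le_one_div_of_le (by positivity)
    have : 0 < (x * (x + 1)) ^ 3 := by positivity
    linarith
  have h3 : 20 * (1 / (x * (x + 1)) ^ 3) ≤ 4 * ((x + 1) ^ 5 - x ^ 5) / (x * (x + 1)) ^ 5 := by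
    have : 20 * (1 / (x * (x + 1)) ^ 3) = 20 * (x * (x + 1)) ^ 2 / (x * (x + 1)) ^ 5 := by
      field_simp
    rw [this]
    gcongr ?_ / _
    nlinarith [sq_nonneg x]
  have h4 : 0 < 1 / (x * (x + 1)) ^ 3 := by positivity
  rw [neg_mul, neg_div, neg_div]
  linarith

noncomputable def auxG (y : ℝ) : ℝ := digamma (y + 1 / 2) - Real.log y - (1 / 24) * (1 / y ^ 2)

lemma auxG_step {y : ℝ} (hy : 0 < y) : auxG (y + 1) - auxG y = auxD y := by
  have := aux_rec (x := y + 1 / 2) (by linarith)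
  rw [show y + 1 / 2 + 1 = y + 1 + 1 / 2 by ring] at this
  simp only [auxG, auxD, this]
  ring

open Filter Topology in
lemma auxG_t : Tendsto auxG atTop (𝓝 0) := by
  have h : Tendsto (fun y : ℝ => digamma (y + 1 / 2) - Real.log y) atTop (𝓝 0) := by
    refine tendsto_of_tendsto_of_tendsto_of_le_of_le' (aux_logt (-1/2)) (aux_logt (1/2)) ?_ ?_
    · filter_upwards [eventually_gt_atTop 1] with y hy
      have := aux_ge (x := y + -1 / 2) (by linarith)
      rw [show y + -1 / 2 + 1 = y + 1 / 2 by ring] at this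
      linarith
    · filter_upwards [eventually_gt_atTop 1] with y hy
      have := aux_le (x := y + 1 / 2) (by linarith)
      linarith
  have := h.sub ((aux_pow 0 2 two_ne_zero).const_mul (1/24))
  rw [show auxG = fun y => _ from funext fun y => auxG.eq_1 y]
  simpa using this

open Filter Topology in
lemma auxG_bound {y : ℝ} (hy : 0 < y) : |auxG y| ≤ 1 / y ^ 4 := by
  have hn : ∀ n : ℕ, auxG y ≤ auxG (y + n) ∧
      auxG (y + n) + 1 / (y + n) ^ 4 ≤ auxG y + 1 / y ^ 4 := by
    intro n
    induction n with
    | zero => simp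
    | succ k ih =>
      have hp : 0 < y + k := by positivity
      have h1 := auxG_step hp
      have h2 := auxD_nonneg hp
      have h3 := auxD_le hp
      simp only [auxH] at h3
      push_cast
      rw [← add_assoc]
      constructor <;> linarith [ih.1, ih.2]
  have ht : Tendsto (fun n : ℕ => y + (n : ℝ)) atTop atTop :=
    tendsto_atTop_add_const_left _ _ tendsto_natCast_atTop_atTop
  have hg := auxG_t.comp ht
  have hq := (aux_pow 0 4 four_ne_zero).comp ht
  have h1 : auxG y ≤ 0 := ge_of_tendsto' hg (fun n => (hn n).1)
  have h2 : 0 + 0 ≤ auxG y + 1 / y ^ 4 :=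
    le_of_tendsto' (hg.add hq) (fun n => by simpa using (hn n).2)
  rw [abs_le]
  constructor
  · linarith
  · have : 0 < 1 / y ^ 4 := by positivity
    linarith

/-- Large-`N` expansion to order `N⁻²`, with error `O(N⁻⁴)`, of the bulk-scaled structure
function of the circular β-ensemble with β = 1 in the regime `τ > 1`. -/
theorem coe_structure_function_expansion_large_tau (τ : ℝ) (hτ : 1 < τ) :
    ∃ C > (0 : ℝ), ∃ N₀ : ℕ, ∀ N : ℕ, N₀ ≤ N →
      |(2 - τ * (digamma (N * (τ + 1 / 2) + 1 / 2) - digamma (N * (τ - 1 / 2) + 1 / 2)))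
          - (2 - τ * Real.log ((2 * τ + 1) / (2 * τ - 1)) +
              4 * τ ^ 2 / (3 * N ^ 2 * (4 * τ ^ 2 - 1) ^ 2))|
        ≤ C / N ^ 4 := by
  have ha : 0 < τ + 1 / 2 := by linarith
  have hb : 0 < τ - 1 / 2 := by linarith
  have h0 : 0 < τ := by linarith
  refine ⟨τ * (1 / (τ + 1 / 2) ^ 4 + 1 / (τ - 1 / 2) ^ 4), by positivity, 1, fun N hN => ?_⟩
  have hN : (0 : ℝ) < N := by exact_mod_cast hN
  have hA := auxG_bound (y := N * (τ + 1 / 2)) (by positivity)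
  have hB := auxG_bound (y := N * (τ - 1 / 2)) (by positivity)
  have hlog : Real.log ((2 * τ + 1) / (2 * τ - 1)) =
      Real.log (N * (τ + 1 / 2)) - Real.log (N * (τ - 1 / 2)) := by
    rw [← Real.log_div (by positivity) (by positivity)]
    congr 1
    rw [div_eq_div_iff (by linarith) (by positivity)]
    ring
  have hr : 4 * τ ^ 2 / (3 * N ^ 2 * (4 * τ ^ 2 - 1) ^ 2) =
      -τ * ((1 / 24) * (1 / (N * (τ + 1 / 2)) ^ 2) - (1 / 24) * (1 / (N * (τ - 1 / 2)) ^ 2)) := by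
    rw [show 4 * τ ^ 2 - 1 = 4 * ((τ + 1 / 2) * (τ - 1 / 2)) by ring]
    generalize hbb : τ - 1 / 2 = b at *
    have : τ = b + 1 / 2 := by linarith
    subst this
    field_simp
    ring
  have key : (2 - τ * (digamma (N * (τ + 1 / 2) + 1 / 2) - digamma (N * (τ - 1 / 2) + 1 / 2)))
          - (2 - τ * Real.log ((2 * τ + 1) / (2 * τ - 1)) +
              4 * τ ^ 2 / (3 * N ^ 2 * (4 * τ ^ 2 - 1) ^ 2))
      = τ * (auxG (N * (τ - 1 / 2)) - auxG (N * (τ + 1 / 2))) := by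
    rw [hlog, hr]
    simp only [auxG]
    ring
  rw [key, abs_mul, abs_of_pos h0, mul_div_assoc]
  gcongr
  calc _ ≤ |auxG (N * (τ - 1 / 2))| + |auxG (N * (τ + 1 / 2))| := abs_sub _ _
    _ ≤ 1 / (N * (τ - 1 / 2)) ^ 4 + 1 / (N * (τ + 1 / 2)) ^ 4 := add_le_add hB hA
    _ = _ := by
      rw [mul_pow, mul_pow]
      field_simp
      ring
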